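/- Let R_1, ..., R_N, R_{N+1} be exchangeable real-valued random variables that are almost surely pairwise distinct. Fix k ∈ {1, ..., N} and let q̂ denote the k-th smallest value among R_1, ..., R_N. Then P(R_{N+1} < q̂) ≤ k/(N+1). In particular, for α ∈ (0,1) and k = ⌊(N+1)α⌋, the coverage guarantee P(R_{N+1} ≥ q̂) ≥ 1 − α holds. -/

import Mathlib

open MeasureTheory
open scoped ENNReal

/-- Among pairwise distinct values, at most `k` have fewer than `k` strictly smaller values. -/
theorem card_filter_card_lt_le {ι : Type*} [Fintype ι] (x : ι → ℝ)
    (hx : Function.Injective x) (k : ℕ) :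
    (Finset.univ.filter fun i => (Finset.univ.filter fun j => x j < x i).card < k).card ≤ k := by
  have hlt : ∀ a b, x a < x b → (Finset.univ.filter fun j => x j < x a).card <
      (Finset.univ.filter fun j => x j < x b).card := by
    intro a b hab
    refine Finset.card_lt_card (Finset.ssubset_iff_of_subset ?_ |>.2 ⟨a, by simpa using hab, by simp⟩)
    intro j hj
    simp only [Finset.mem_filter, Finset.mem_univ, true_and] at hj ⊢
    exact hj.trans hab
  have h := Finset.card_le_card_of_injOn
    (s := Finset.univ.filter fun i => (Finset.univ.filter fun j => x j < x i).card < k)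
    (t := Finset.range k) (fun i => (Finset.univ.filter fun j => x j < x i).card)
    (fun i hi => by simpa using hi)
    (fun a _ b _ hab => by
      dsimp only at hab
      by_contra hne
      rcases lt_or_gt_of_ne (hx.ne hne) with h | h
      · exact (hlt a b h).ne hab
      · exact (hlt b a h).ne' hab)
  simpa using h

theorem measurableSet_card_lt {ι : Type*} [Fintype ι] (i : ι) (k : ℕ) :
    MeasurableSet {x : ι → ℝ | (Finset.univ.filter fun j => x j < x i).card < k} := by
  have hm : Measurable fun x : ι → ℝ => (Finset.univ.filter fun j => x j < x i).card := by
    simp only [Finset.card_filter]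
    refine Finset.measurable_sum _ fun j _ => ?_
    exact Measurable.ite (measurableSet_lt (measurable_pi_apply j) (measurable_pi_apply i))
      measurable_const measurable_const
  exact hm measurableSet_Iio

/-- For exchangeable, almost surely distinct random variables, the probability that a given one
has fewer than `k` strictly smaller ones is at most `k` over the number of variables. -/
theorem card_mul_measure_card_lt_le {ι Ω : Type*} [Fintype ι] [MeasurableSpace Ω]
    (μ : Measure Ω) [IsProbabilityMeasure μ] (R : ι → Ω → ℝ) (hmeas : ∀ i, Measurable (R i))
    (hexch : ∀ π : Equiv.Perm ι,
      Measure.map (fun ω => fun i => R (π i) ω) μ = Measure.map (fun ω => fun i => R i ω) μ)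
    (hdistinct : ∀ᵐ ω ∂μ, Function.Injective fun i => R i ω) (i₀ : ι) (k : ℕ) :
    (Fintype.card ι : ℝ≥0∞) *
      μ {ω | (Finset.univ.filter fun j => R j ω < R i₀ ω).card < k} ≤ k := by
  classical
  set A : ι → Set Ω := fun i => {ω | (Finset.univ.filter fun j => R j ω < R i ω).card < k} with hA
  have hAm : ∀ i, MeasurableSet (A i) := fun i =>
    measurable_pi_lambda (fun ω i => R i ω) hmeas (measurableSet_card_lt i k)
  have heq : ∀ i, μ (A i) = μ (A i₀) := by
    intro i
    have h := congrArg (fun ν => ν {x : ι → ℝ | (Finset.univ.filter fun j => x j < x i₀).card < k})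
      (hexch (Equiv.swap i₀ i))
    rw [Measure.map_apply (measurable_pi_lambda _ fun j => hmeas _) (measurableSet_card_lt i₀ k),
      Measure.map_apply (measurable_pi_lambda _ hmeas) (measurableSet_card_lt i₀ k)] at h
    refine Eq.trans (congrArg μ ?_) h
    ext ω
    simp only [hA, Set.mem_ofPred_eq, Set.mem_preimage, Equiv.swap_apply_left]
    rw [Finset.card_equiv (Equiv.swap i₀ i)
      (s := Finset.univ.filter fun j => R j ω < R i ω)
      (t := Finset.univ.filter fun j => R (Equiv.swap i₀ i j) ω < R i ω) (by simp)]
  calc (Fintype.card ι : ℝ≥0∞) * μ (A i₀) = ∑ i, μ (A i) := by simp [heq]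
    _ = ∑ i, ∫⁻ ω, (A i).indicator 1 ω ∂μ := by simp [hAm]
    _ = ∫⁻ ω, ∑ i, (A i).indicator 1 ω ∂μ :=
      (lintegral_finsetSum _ fun i _ => measurable_one.indicator (hAm i)).symm
    _ ≤ ∫⁻ _, (k : ℝ≥0∞) ∂μ := by
      refine lintegral_mono_ae (hdistinct.mono fun ω hω => ?_)
      have h := card_filter_card_lt_le (fun i => R i ω) hω k
      simp only [Set.indicator_apply, Pi.one_apply, Finset.sum_boole, hA, Set.mem_ofPred_eq]
      exact_mod_cast h
    _ = k := by simp

/-- **Split conformal prediction coverage guarantee.**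
Let `R 0, …, R N` (indices in `Fin (N+1)`) be exchangeable real-valued random
variables that are almost surely pairwise distinct.  Fix `k ∈ {1, …, N}` and let
`q` be the `k`-th smallest value among the first `N` of them (the calibration
scores), characterized by: `q ω` is attained by some calibration score and
exactly `k` calibration scores are `≤ q ω`.  Then
`P(R_{N+1} < q) ≤ k / (N+1)`, and in particular for `α ∈ (0,1)` and
`k = ⌊(N+1)α⌋` we get the coverage guarantee `P(R_{N+1} ≥ q) ≥ 1 - α`. -/
theorem conformal_coverage
    {Ω : Type*} [MeasurableSpace Ω] (μ : Measure Ω) [IsProbabilityMeasure μ]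
    (N : ℕ) (hN : 0 < N)
    (R : Fin (N + 1) → Ω → ℝ) (hmeas : ∀ i, Measurable (R i))
    (hexch : ∀ π : Equiv.Perm (Fin (N + 1)),
      Measure.map (fun ω => fun i => R (π i) ω) μ
        = Measure.map (fun ω => fun i => R i ω) μ)
    (hdistinct : ∀ᵐ ω ∂μ, ∀ i j : Fin (N + 1), i ≠ j → R i ω ≠ R j ω)
    (k : ℕ) (hk1 : 1 ≤ k) (hkN : k ≤ N)
    (q : Ω → ℝ)
    (hq : ∀ᵐ ω ∂μ, (∃ i : Fin N, R i.castSucc ω = q ω) ∧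
      {i : Fin N | R i.castSucc ω ≤ q ω}.ncard = k) :
    μ {ω | R (Fin.last N) ω < q ω} ≤ (k : ℝ≥0∞) / (N + 1) ∧
    ∀ α : ℝ, α ∈ Set.Ioo (0 : ℝ) 1 → k = ⌊((N : ℝ) + 1) * α⌋₊ →
      ENNReal.ofReal (1 - α) ≤ μ {ω | q ω ≤ R (Fin.last N) ω} := by
  have hmain : μ {ω | R (Fin.last N) ω < q ω} ≤ (k : ℝ≥0∞) / (N + 1) := by
    rw [ENNReal.le_div_iff_mul_le (by simp) (by simp), mul_comm]
    have hR := card_mul_measure_card_lt_le μ R hmeas hexch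
      (hdistinct.mono fun ω h i j hij => by_contra fun hne => h i j hne hij) (Fin.last N) k
    simp only [Fintype.card_fin, Nat.cast_add, Nat.cast_one] at hR
    refine le_trans (mul_le_mul_right (measure_mono_ae ?_) _) hR
    filter_upwards [hq] with ω ⟨⟨i, hi⟩, hk⟩ hlt
    change R (Fin.last N) ω < q ω at hlt
    change (Finset.univ.filter fun j => R j ω < R (Fin.last N) ω).card < k
    rw [← hk, Set.ncard_eq_toFinset_card', Finset.card_filter, Fin.sum_univ_castSucc, if_neg (lt_irrefl _),
      add_zero, ← Finset.card_filter]
    refine Finset.card_lt_card (Finset.ssubset_iff_of_subset ?_ |>.2 ⟨i, ?_, ?_⟩)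
    · intro j hj
      simp only [Finset.mem_filter, Finset.mem_univ, true_and,
        Set.mem_toFinset, Set.mem_ofPred_eq] at hj ⊢
      exact (hj.trans hlt).le
    · simp [hi]
    · simp [hi, hlt.le]
  refine ⟨hmain, fun α hα hkα => ?_⟩
  have hfloor : (k : ℝ) ≤ ((N : ℝ) + 1) * α := by
    rw [hkα]
    exact Nat.floor_le (mul_nonneg (by positivity) hα.1.le)
  have hle : (k : ℝ≥0∞) / (N + 1) ≤ ENNReal.ofReal α := by
    refine ENNReal.div_le_of_le_mul' ?_
    have h := ENNReal.ofReal_le_ofReal hfloor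
    rwa [ENNReal.ofReal_mul (by positivity), ENNReal.ofReal_add (by positivity) zero_le_one,
      ENNReal.ofReal_natCast, ENNReal.ofReal_natCast, ENNReal.ofReal_one] at h
  rw [ENNReal.ofReal_sub _ hα.1.le, ENNReal.ofReal_one, tsub_le_iff_right]
  calc (1 : ℝ≥0∞) = μ ({ω | q ω ≤ R (Fin.last N) ω} ∪ {ω | R (Fin.last N) ω < q ω}) := by
        rw [← measure_univ (μ := μ)]
        congr 1
        ext ω
        simp [le_or_gt]
    _ ≤ μ {ω | q ω ≤ R (Fin.last N) ω} + μ {ω | R (Fin.last N) ω < q ω} := measure_union_le _ _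
    _ ≤ μ {ω | q ω ≤ R (Fin.last N) ω} + ENNReal.ofReal α := by gcongr; exact hmain.trans hle
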